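/- Fix r ≥ 1, t > 0, V > 0 and n ≥ r, and let S_r(V, t) := {θ ∈ ℝ^n : ‖θ‖ ≤ t, ‖D^{(r)}θ‖₁ ≤ V n^{1−r}}. There exists a constant C_r depending only on r such that for every ε > 0, the metric entropy satisfies log N(ε, S_r(V, t)) ≤ C_r (V√n/ε)^{1/r} + r·log( 2 + 2^r n^r t/(ε√n) ) + C_r. -/

import Mathlib

open MeasureTheory ProbabilityTheory
open scoped BigOperators

noncomputable section

/-- Zero-padding of a finite vector to a sequence on `ℕ`. -/
def pad {n : ℕ} (θ : Fin n → ℝ) : ℕ → ℝ := fun t => if h : t < n then θ ⟨t, h⟩ else 0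

/-- First-order forward difference of a sequence. -/
def dseq (f : ℕ → ℝ) : ℕ → ℝ := fun t => f (t + 1) - f t

/-- `DD r θ t` is the `t`-th entry (0-indexed) of the `r`-th order difference `D^{(r)} θ`
of the vector `θ ∈ ℝ^n`; only the entries `t < n - r` are meaningful. -/
def DD (r : ℕ) {n : ℕ} (θ : Fin n → ℝ) : ℕ → ℝ := dseq^[r] (pad θ)

/-- The ℓ¹ norm `‖D^{(r)} θ‖₁`. -/
def Dl1 (r : ℕ) {n : ℕ} (θ : Fin n → ℝ) : ℝ := ∑ t ∈ Finset.range (n - r), |DD r θ t|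

/-- The number of nonzero entries `‖D^{(r)} θ‖₀`. -/
def Dl0 (r : ℕ) {n : ℕ} (θ : Fin n → ℝ) : ℕ :=
  ((Finset.range (n - r)).filter fun t => DD r θ t ≠ 0).card

/-- Squared Euclidean norm. -/
def sqnorm {n : ℕ} (x : Fin n → ℝ) : ℝ := ∑ i, x i ^ 2

/-- Euclidean norm. -/
def eunorm {n : ℕ} (x : Fin n → ℝ) : ℝ := Real.sqrt (sqnorm x)

/-- `V^{(r)}(θ) = n^{r-1} ‖D^{(r)} θ‖₁`. -/
def Vr (r : ℕ) {n : ℕ} (θ : Fin n → ℝ) : ℝ := (n : ℝ) ^ ((r : ℤ) - 1) * Dl1 r θ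

/-- The constraint set `K^{(r)}(V) = {θ : ‖D^{(r)} θ‖₁ ≤ V n^{1-r}}`. -/
def Kset (r n : ℕ) (V : ℝ) : Set (Fin n → ℝ) := {θ | Dl1 r θ ≤ V * (n : ℝ) ^ (1 - (r : ℤ))}

/-- `est` is a least-squares projection onto the set `K`. -/
def IsProjOn {n : ℕ} (est : (Fin n → ℝ) → Fin n → ℝ) (K : Set (Fin n → ℝ)) : Prop :=
  ∀ y, est y ∈ K ∧ ∀ θ ∈ K, sqnorm (y - est y) ≤ sqnorm (y - θ)

/-- `est` is the penalized trend filtering estimator of order `r` with noise level `σ`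
and tuning parameter `lam`: it minimizes `½‖y - θ‖² + σ n^{r-1} lam ‖D^{(r)} θ‖₁`. -/
def IsPenEst (r : ℕ) {n : ℕ} (σ lam : ℝ) (est : (Fin n → ℝ) → Fin n → ℝ) : Prop :=
  ∀ y θ, 1 / 2 * sqnorm (y - est y) + σ * (n : ℝ) ^ ((r : ℤ) - 1) * lam * Dl1 r (est y) ≤
    1 / 2 * sqnorm (y - θ) + σ * (n : ℝ) ^ ((r : ℤ) - 1) * lam * Dl1 r θ

/-- The Gaussian measure `N_n(0, σ² I_n)` on `ℝ^n`. -/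
def gaussVec (n : ℕ) (σ : ℝ) : Measure (Fin n → ℝ) :=
  Measure.pi fun _ => gaussianReal 0 (σ ^ 2).toNNReal

/-- The risk `R(θ̂, θ*) = (1/n) E ‖θ̂(θ* + ξ) - θ*‖²` for `ξ ∼ N_n(0, σ² I_n)`. -/
def risk {n : ℕ} (σ : ℝ) (est : (Fin n → ℝ) → Fin n → ℝ) (θs : Fin n → ℝ) : ℝ :=
  1 / (n : ℝ) * ∫ ξ, sqnorm (est (θs + ξ) - θs) ∂gaussVec n σ

/-- `j` (with signs `sg`) enumerates, in increasing order and paper (1-indexed) convention,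
exactly the `r`-th order knots of `θ ∈ ℝ^n`; an index `2 ≤ m ≤ n - r + 1` is a knot when
`(D^{(r-1)}θ)_{m-1} ≠ (D^{(r-1)}θ)_m` (1-indexed entries), and its sign is `+1` when
`(D^{(r-1)}θ)_{m-1} < (D^{(r-1)}θ)_m` and `-1` otherwise. -/
def IsKnotSeq (r n : ℕ) (θ : Fin n → ℝ) (k : ℕ) (j : Fin k → ℕ) (sg : Fin k → ℝ) : Prop :=
  StrictMono j ∧ (∀ i, 2 ≤ j i ∧ j i ≤ n - r + 1) ∧
    (∀ m : ℕ, 2 ≤ m → m ≤ n - r + 1 →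
      (DD (r - 1) θ (m - 2) ≠ DD (r - 1) θ (m - 1) ↔ ∃ i, j i = m)) ∧
    ∀ i, sg i = if DD (r - 1) θ (j i - 2) < DD (r - 1) θ (j i - 1) then 1 else -1

/-- Extended knot sequence: `jext 0 = j_0 = 1`, `jext i = j_i` for `1 ≤ i ≤ k`, and
`jext (k+1) = j_{k+1} = n - r + 2`. -/
def jext (n r k : ℕ) (j : Fin k → ℕ) : ℕ → ℕ := fun i =>
  if i = 0 then 1 else if h : i - 1 < k then j ⟨i - 1, h⟩ else n - r + 2

/-- Extended sign sequence: `sgext i = 𝔯_i` for `1 ≤ i ≤ k` and `0` otherwise. -/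
def sgext (k : ℕ) (sg : Fin k → ℝ) : ℕ → ℝ := fun i =>
  if h : 0 < i ∧ i - 1 < k then sg ⟨i - 1, h.2⟩ else 0

/-- The lengths `n_0 = j_1 + r - 2`, `n_i = j_{i+1} - j_i` (`1 ≤ i ≤ k-1`),
`n_k = n - r + 2 - j_k`. -/
def nlen (n r k : ℕ) (j : Fin k → ℕ) : ℕ → ℕ := fun i =>
  if i = 0 then jext n r k j 1 + r - 2 else jext n r k j (i + 1) - jext n r k j i

/-- `n_{i*} = min(n_i, n/(k+1))`. -/
def nstar (n r k : ℕ) (j : Fin k → ℕ) (i : ℕ) : ℝ :=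
  min (nlen n r k j i : ℝ) ((n : ℝ) / ((k : ℝ) + 1))

/-- `δ_r(θ)²` defined from the knot data of `θ`. -/
def deltaSq (n r k : ℕ) (j : Fin k → ℕ) (sg : Fin k → ℝ) : ℝ :=
  nstar n r k j 0 ^ (1 - 2 * (r : ℤ)) + nstar n r k j k ^ (1 - 2 * (r : ℤ)) +
    ∑ i ∈ Finset.Ico 1 k,
      if sgext k sg i ≠ sgext k sg (i + 1) then nstar n r k j i ^ (1 - 2 * (r : ℤ)) else 0

/-- `Δ_r(θ)` defined from the knot data of `θ`. -/
def DeltaR (n r k : ℕ) (j : Fin k → ℕ) (sg : Fin k → ℝ) : ℝ :=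
  ((k : ℝ) + 1) / (n : ℝ) * Real.log (Real.exp 1 * (n : ℝ) / ((k : ℝ) + 1)) +
    deltaSq n r k j sg / (n : ℝ) * ((n : ℝ) / ((k : ℝ) + 1)) ^ (2 * (r : ℤ) - 1) *
      Real.log (Real.exp 1 * (n : ℝ) / ((k : ℝ) + 1)) +
    (Real.sqrt (deltaSq n r k j sg) / Real.sqrt (n : ℝ)) ^ ((1 : ℝ) / (r : ℝ))

/-- The minimum length condition with constant `c`: `n_i ≥ c n/(k+1)` for every `0 ≤ i ≤ k`
with `𝔯_i ≠ 𝔯_{i+1}` (where `𝔯_0 = 𝔯_{k+1} = 0`). -/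
def MinLen (n r k : ℕ) (j : Fin k → ℕ) (sg : Fin k → ℝ) (c : ℝ) : Prop :=
  ∀ i ≤ k, sgext k sg i ≠ sgext k sg (i + 1) →
    c * (n : ℝ) / ((k : ℝ) + 1) ≤ (nlen n r k j i : ℝ)

/-- The subdifferential of `g` at `θ`. -/
def subdiff {n : ℕ} (g : (Fin n → ℝ) → ℝ) (θ : Fin n → ℝ) : Set (Fin n → ℝ) :=
  {v | ∀ y, g θ + ∑ i, v i * (y i - θ i) ≤ g y}

/-- `v` is the minimum-norm element of `S`. -/
def IsMinNormIn {n : ℕ} (v : Fin n → ℝ) (S : Set (Fin n → ℝ)) : Prop :=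
  v ∈ S ∧ ∀ w ∈ S, eunorm v ≤ eunorm w

/-- `c • S`. -/
def scaleSet {n : ℕ} (c : ℝ) (S : Set (Fin n → ℝ)) : Set (Fin n → ℝ) := (c • ·) '' S

/-- The cone generated by `S`: `⋃_{c ≥ 0} c • S`. -/
def coneOf {n : ℕ} (S : Set (Fin n → ℝ)) : Set (Fin n → ℝ) := ⋃ c ∈ Set.Ici (0 : ℝ), scaleSet c S

/-- Euclidean distance from a point to a set. -/
def distSet {n : ℕ} (z : Fin n → ℝ) (S : Set (Fin n → ℝ)) : ℝ :=
  sInf ((fun v => eunorm (z - v)) '' S)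

/-- Gaussian mean squared distance `D(S) = E dist²(Z, S)`, `Z ∼ N_n(0, I_n)`. -/
def gaussMSD {n : ℕ} (S : Set (Fin n → ℝ)) : ℝ := ∫ z, distSet z S ^ 2 ∂gaussVec n 1

/-- `lam z` is, for each `z`, the minimizer over `λ ≥ 0` of `dist(z, λ S)`. -/
def IsLamFun {n : ℕ} (S : Set (Fin n → ℝ)) (lam : (Fin n → ℝ) → ℝ) : Prop :=
  ∀ z, 0 ≤ lam z ∧ ∀ μ : ℝ, 0 ≤ μ → distSet z (scaleSet (lam z) S) ≤ distSet z (scaleSet μ S)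

/-- Euclidean covering number of `K` at scale `ε`. -/
def covN {n : ℕ} (ε : ℝ) (K : Set (Fin n → ℝ)) : ℕ :=
  sInf {m : ℕ | ∃ a : Fin m → Fin n → ℝ, ∀ x ∈ K, ∃ i, eunorm (x - a i) ≤ ε}

/-- `K` `t`-shatters the (finite) index set `A`. -/
def fatShatters {n : ℕ} (K : Set (Fin n → ℝ)) (t : ℝ) (A : Finset (Fin n)) : Prop :=
  ∃ h : Fin n → ℝ, ∀ S : Finset (Fin n), S ⊆ A →
    ∃ θ ∈ K, (∀ i ∈ S, θ i ≤ h i) ∧ ∀ i ∈ A, i ∉ S → h i + t ≤ θ i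

/-- The fat shattering dimension `v(K, t)`. -/
def fatDim {n : ℕ} (K : Set (Fin n → ℝ)) (t : ℝ) : ℕ :=
  sSup {m : ℕ | ∃ A : Finset (Fin n), A.card = m ∧ fatShatters K t A}

/-- The tangent cone of `K` at `θ`. -/
def tanCone {n : ℕ} (K : Set (Fin n → ℝ)) (θ : Fin n → ℝ) : Set (Fin n → ℝ) :=
  closure {w | ∃ t : ℝ, 0 ≤ t ∧ ∃ η ∈ K, w = t • (η - θ)}

/-- `V_{a,b}(f) = Σ_{m=a+1}^{b} |f_m - f_{m-1}|` for the (paper 1-indexed) sequence whose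
`m`-th entry is `f (m-1)`. -/
def Vab (f : ℕ → ℝ) (a b : ℕ) : ℝ := ∑ t ∈ Finset.Ico (a - 1) (b - 1), |f (t + 1) - f t|

/-- `Acoef r n v j = Σ_{i=j}^n C(r+i-j-1, r-1) v_i` (paper 1-indexed). -/
def Acoef (r n : ℕ) (v : Fin n → ℝ) (jj : ℕ) : ℝ :=
  ∑ i : Fin n, (if jj ≤ i.1 + 1 then ((r + (i.1 + 1) - jj - 1).choose (r - 1) : ℝ) else 0) * v i

/-- The class `C_r({a_i}, {s_i})`. -/
def Cras (r n : ℕ) (a s : ℕ → ℝ) : Set (Fin n → ℝ) :=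
  {θ | (∀ i < r - 1, a i ≤ DD i θ 0 ∧ DD i θ 0 ≤ a i + s i) ∧
    a (r - 1) ≤ DD (r - 1) θ 0 ∧
    (∀ t : ℕ, t + 1 ≤ n - r → DD (r - 1) θ t ≤ DD (r - 1) θ (t + 1)) ∧
    DD (r - 1) θ (n - r) ≤ a (r - 1) + s (r - 1)}

/-- The class `C_r(a, V) = {θ : a ≤ (D^{(r-1)}θ)_1 ≤ ⋯ ≤ (D^{(r-1)}θ)_{n-r+1} ≤ a + V}`. -/
def CrMono (r n : ℕ) (a V : ℝ) : Set (Fin n → ℝ) :=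
  {θ | a ≤ DD (r - 1) θ 0 ∧
    (∀ t : ℕ, t + 1 ≤ n - r → DD (r - 1) θ t ≤ DD (r - 1) θ (t + 1)) ∧
    DD (r - 1) θ (n - r) ≤ a + V}


/-! ### Discrete Taylor expansion -/

lemma aux_taylor (m : ℕ) : ∀ (g : ℕ → ℝ) (a x : ℕ),
    |g (a + x) - ∑ k ∈ Finset.range (m + 1), (x.choose k : ℝ) * dseq^[k] g a| ≤
      (x : ℝ) ^ m * ∑ u ∈ Finset.range x, |dseq^[m + 1] g (a + u)| := by
  induction m with
  | zero =>
    intro g a x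
    have : g (a + x) - ∑ k ∈ Finset.range (0 + 1), (x.choose k : ℝ) * dseq^[k] g a
        = ∑ u ∈ Finset.range x, dseq^[0 + 1] g (a + u) := by
      simp only [zero_add, Finset.sum_range_one, Nat.choose_zero_right, Nat.cast_one, one_mul,
        Function.iterate_zero, id, Function.iterate_one]
      have := Finset.sum_range_sub (fun u => g (a + u)) x
      simp only [add_zero] at this
      rw [← this]
      rfl
    rw [this, pow_zero, one_mul]
    exact Finset.abs_sum_le_sum_abs _ _
  | succ m ih =>
    intro g a x
    set R : ℕ → ℝ := fun x =>
      g (a + x) - ∑ k ∈ Finset.range (m + 1 + 1), (x.choose k : ℝ) * dseq^[k] g a with hR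
    have h0 : R 0 = 0 := by
      simp only [hR]
      rw [Finset.sum_range_succ']
      simp
    have hstep : ∀ y, R (y + 1) - R y = dseq g (a + y) -
        ∑ k ∈ Finset.range (m + 1), (y.choose k : ℝ) * dseq^[k] (dseq g) a := by
      intro y
      simp only [hR]
      rw [Finset.sum_range_succ' _ (m + 1), Finset.sum_range_succ' _ (m + 1)]
      have hd : dseq g (a + y) = g (a + (y + 1)) - g (a + y) := rfl
      rw [hd]
      simp only [Nat.choose_succ_succ', Nat.cast_add, add_mul, Finset.sum_add_distrib,
        Function.iterate_succ_apply, Nat.choose_zero_right]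
      ring
    have hx : R x = ∑ y ∈ Finset.range x, (dseq g (a + y) -
        ∑ k ∈ Finset.range (m + 1), (y.choose k : ℝ) * dseq^[k] (dseq g) a) := by
      have := Finset.sum_range_sub R x
      rw [h0, sub_zero] at this
      rw [← this]
      exact Finset.sum_congr rfl fun y _ => hstep y
    change |R x| ≤ _
    rw [hx]
    refine (Finset.abs_sum_le_sum_abs _ _).trans ?_
    have hb : ∀ y ∈ Finset.range x, |dseq g (a + y) -
        ∑ k ∈ Finset.range (m + 1), (y.choose k : ℝ) * dseq^[k] (dseq g) a| ≤
        (x : ℝ) ^ m * ∑ u ∈ Finset.range x, |dseq^[m + 1 + 1] g (a + u)| := by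
      intro y hy
      have hyx : y ≤ x := (Finset.mem_range.mp hy).le
      refine (ih (dseq g) a y).trans ?_
      refine mul_le_mul ?_ ?_ (Finset.sum_nonneg fun _ _ => abs_nonneg _) (by positivity)
      · gcongr
      · simp only [Function.iterate_succ_apply]
        exact Finset.sum_le_sum_of_subset_of_nonneg (Finset.range_mono hyx)
          fun _ _ _ => abs_nonneg _
    refine (Finset.sum_le_sum hb).trans ?_
    rw [Finset.sum_const, Finset.card_range, nsmul_eq_mul, pow_succ]
    apply le_of_eq; ring

lemma aux_congr (r : ℕ) : ∀ (f g : ℕ → ℝ) (n : ℕ), (∀ j < n, f j = g j) →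
    ∀ k, k + r < n → dseq^[r] f k = dseq^[r] g k := by
  induction r with
  | zero => intro f g n h k hk; exact h k (by omega)
  | succ r ih =>
    intro f g n h k hk
    simp only [Function.iterate_succ_apply]
    refine ih (dseq f) (dseq g) (n - 1) ?_ k (by omega)
    intro j hj
    simp only [dseq]
    rw [h j (by omega), h (j + 1) (by omega)]

lemma aux_ext (r : ℕ) : ∀ (g : ℕ → ℝ) (n : ℕ), r ≤ n → ∃ f : ℕ → ℝ,
    (∀ j < n, f j = g j) ∧ ∀ k, n - r ≤ k → dseq^[r] f k = 0 := by
  induction r with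
  | zero =>
    intro g n _
    refine ⟨fun j => if j < n then g j else 0, fun j hj => by simp [hj], fun k hk => ?_⟩
    have : ¬ k < n := by omega
    simp [this]
  | succ r ih =>
    intro g n hn
    obtain ⟨f', h1, h2⟩ := ih (dseq g) (n - 1) (by omega)
    have hd : dseq (fun j => g 0 + ∑ i ∈ Finset.range j, f' i) = f' := by
      funext j
      simp only [dseq, Finset.sum_range_succ]
      ring
    refine ⟨fun j => g 0 + ∑ i ∈ Finset.range j, f' i, ?_, ?_⟩
    · intro j hj
      have : ∑ i ∈ Finset.range j, f' i = ∑ i ∈ Finset.range j, (g (i + 1) - g i) := by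
        refine Finset.sum_congr rfl fun i hi => ?_
        have := Finset.mem_range.mp hi
        exact h1 i (by omega)
      simp only [this, Finset.sum_range_sub]
      ring
    · intro k hk
      rw [Function.iterate_succ_apply, hd]
      exact h2 k (by omega)

lemma aux_dbound (t : ℝ) (i : ℕ) : ∀ (g : ℕ → ℝ), (∀ j, |g j| ≤ t) →
    ∀ j, |dseq^[i] g j| ≤ 2 ^ i * t := by
  induction i with
  | zero => intro g h j; simpa using h j
  | succ i ih =>
    intro g h j
    rw [Function.iterate_succ_apply']
    have h1 := ih g h j
    have h2 := ih g h (j + 1)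
    simp only [dseq]
    calc _ ≤ _ := abs_sub _ _
      _ ≤ 2 ^ i * t + 2 ^ i * t := add_le_add h2 h1
      _ = _ := by ring

/-! ### Dyadic decomposition -/

/-- Piecewise Taylor polynomial at scale `2^s`. -/
def auxP (r : ℕ) (f : ℕ → ℝ) (s j : ℕ) : ℝ :=
  ∑ k ∈ Finset.range r, ((j % 2 ^ s).choose k : ℝ) * dseq^[k] f (2 ^ s * (j / 2 ^ s))

/-- Taylor remainder coefficients between consecutive dyadic scales. -/
def auxE (r : ℕ) (f : ℕ → ℝ) (s u i : ℕ) : ℝ :=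
  dseq^[i] f (2 ^ (s + 1) * u + 2 ^ s) -
    ∑ k ∈ Finset.range (r - i), ((2 ^ s).choose k : ℝ) * dseq^[k] (dseq^[i] f) (2 ^ (s + 1) * u)

lemma auxP_zero (r : ℕ) (hr : 1 ≤ r) (f : ℕ → ℝ) (j : ℕ) : auxP r f 0 j = f j := by
  obtain ⟨r, rfl⟩ : ∃ r', r = r' + 1 := ⟨r - 1, by omega⟩
  unfold auxP
  rw [Finset.sum_range_succ']
  simp [Nat.mod_one]

lemma auxP_top (r : ℕ) (f : ℕ → ℝ) (L j : ℕ) (hj : j < 2 ^ L) :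
    auxP r f L j = ∑ k ∈ Finset.range r, (j.choose k : ℝ) * dseq^[k] f 0 := by
  unfold auxP
  rw [Nat.mod_eq_of_lt hj, Nat.div_eq_of_lt hj, mul_zero]

lemma aux_shift (r x y : ℕ) (c : ℕ → ℝ) :
    ∑ k ∈ Finset.range r, ((x + y).choose k : ℝ) * c k =
      ∑ i ∈ Finset.range r, (x.choose i : ℝ) *
        ∑ k ∈ Finset.range (r - i), (y.choose k : ℝ) * c (k + i) := by
  have : ∀ k, ((x + y).choose k : ℝ) =
      ∑ i ∈ Finset.range (k + 1), (x.choose i : ℝ) * (y.choose (k - i) : ℝ) := by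
    intro k
    rw [Nat.add_choose_eq, Finset.Nat.sum_antidiagonal_eq_sum_range_succ_mk]
    push_cast
    rfl
  simp only [this, Finset.sum_mul, Finset.mul_sum]
  rw [Finset.sum_sigma', Finset.sum_sigma']
  refine Finset.sum_bij' (fun p _ => ⟨p.2, p.1 - p.2⟩) (fun p _ => ⟨p.2 + p.1, p.1⟩) ?_ ?_ ?_ ?_ ?_
  · rintro ⟨a, b⟩ h
    simp only [Finset.mem_sigma, Finset.mem_range] at h ⊢
    omega
  · rintro ⟨a, b⟩ h
    simp only [Finset.mem_sigma, Finset.mem_range] at h ⊢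
    omega
  · rintro ⟨a, b⟩ h
    simp only [Finset.mem_sigma, Finset.mem_range] at h ⊢
    have : a - b + b = a := by omega
    simp [this]
  · rintro ⟨a, b⟩ h
    simp
  · rintro ⟨a, b⟩ h
    simp only [Finset.mem_sigma, Finset.mem_range] at h ⊢
    have : a - b + b = a := by omega
    rw [this]; ring

lemma auxP_diff (r : ℕ) (f : ℕ → ℝ) (s j : ℕ) :
    auxP r f s j - auxP r f (s + 1) j =
      if (j / 2 ^ s) % 2 = 1 then
        ∑ i ∈ Finset.range r, ((j % 2 ^ s).choose i : ℝ) * auxE r f s (j / 2 ^ (s + 1)) i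
      else 0 := by
  have hdiv : j / 2 ^ (s + 1) = j / 2 ^ s / 2 := by rw [pow_succ, Nat.div_div_eq_div_mul]
  have hmod : j % 2 ^ (s + 1) = j % 2 ^ s + 2 ^ s * (j / 2 ^ s % 2) := by
    rw [pow_succ, Nat.mod_mul]
  have hq := Nat.div_add_mod (j / 2 ^ s) 2
  split_ifs with h
  · rw [h] at hq hmod
    have hb : 2 ^ s * (j / 2 ^ s) = 2 ^ (s + 1) * (j / 2 ^ (s + 1)) + 2 ^ s := by
      rw [hdiv]
      conv_lhs => rw [← hq]
      ring
    unfold auxP auxE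
    rw [hmod, mul_one, aux_shift r (j % 2 ^ s) (2 ^ s)
      (fun k => dseq^[k] f (2 ^ (s + 1) * (j / 2 ^ (s + 1)))), hb, ← Finset.sum_sub_distrib]
    refine Finset.sum_congr rfl fun i _ => ?_
    rw [mul_sub]
    simp only [Function.iterate_add_apply]
  · have h' : j / 2 ^ s % 2 = 0 := by omega
    rw [h'] at hq hmod
    have hb : 2 ^ s * (j / 2 ^ s) = 2 ^ (s + 1) * (j / 2 ^ (s + 1)) := by
      rw [hdiv]
      conv_lhs => rw [← hq]
      ring
    unfold auxP
    rw [hmod, hb]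
    simp

lemma auxE_bound (r : ℕ) (f : ℕ → ℝ) (s u i : ℕ) (hi : i < r) :
    |auxE r f s u i| ≤ ((2 : ℝ) ^ s) ^ (r - 1 - i) *
      ∑ v ∈ Finset.range (2 ^ s), |dseq^[r] f (2 ^ (s + 1) * u + v)| := by
  have h := aux_taylor (r - 1 - i) (dseq^[i] f) (2 ^ (s + 1) * u) (2 ^ s)
  have e1 : r - 1 - i + 1 = r - i := by omega
  have e2 : r - i + i = r := by omega
  simp only [e1, ← Function.iterate_add_apply, e2] at h
  unfold auxE
  simp only [← Function.iterate_add_apply]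
  push_cast at h
  exact h

lemma aux_sum_blocks (a b : ℕ) (h : ℕ → ℝ) :
    ∑ u ∈ Finset.range b, ∑ v ∈ Finset.range a, h (a * u + v) =
      ∑ j ∈ Finset.range (a * b), h j := by
  induction b with
  | zero => simp
  | succ b ih => rw [Finset.sum_range_succ, ih, Nat.mul_succ, Finset.sum_range_add]

lemma auxE_sum (r : ℕ) (f : ℕ → ℝ) (s m i : ℕ) (hi : i < r) (W : ℝ)
    (hW : ∀ X, ∑ k ∈ Finset.range X, |dseq^[r] f k| ≤ W) :
    ∑ u ∈ Finset.range m, |auxE r f s u i| ≤ ((2 : ℝ) ^ s) ^ (r - 1 - i) * W := by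
  calc _ ≤ ∑ u ∈ Finset.range m, ((2 : ℝ) ^ s) ^ (r - 1 - i) *
      ∑ v ∈ Finset.range (2 ^ (s + 1)), |dseq^[r] f (2 ^ (s + 1) * u + v)| := by
        refine Finset.sum_le_sum fun u _ => (auxE_bound r f s u i hi).trans ?_
        refine mul_le_mul_of_nonneg_left ?_ (by positivity)
        exact Finset.sum_le_sum_of_subset_of_nonneg
          (Finset.range_mono (Nat.pow_le_pow_right (by norm_num) (by omega)))
          fun _ _ _ => abs_nonneg _
    _ = ((2 : ℝ) ^ s) ^ (r - 1 - i) * ∑ j ∈ Finset.range (2 ^ (s + 1) * m), |dseq^[r] f j| := by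
        rw [← Finset.mul_sum, aux_sum_blocks _ _ (fun j => |dseq^[r] f j|)]
    _ ≤ _ := mul_le_mul_of_nonneg_left (hW _) (by positivity)

/-! ### Counting integer vectors and quantization -/

lemma aux_geom (K : ℕ) (q : ℝ) (h0 : 0 < q) (h1 : q < 1) :
    ∑ k ∈ Finset.Icc (-(K : ℤ)) K, q ^ k.natAbs ≤ (1 + q) / (1 - q) := by
  have hgeo : ∀ m : ℕ, ∑ k ∈ Finset.range m, q ^ k ≤ 1 / (1 - q) := by
    intro m
    rw [geom_sum_eq h1.ne, ← neg_div_neg_eq]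
    have : 0 < 1 - q := by linarith
    rw [neg_sub, neg_sub]
    gcongr
    have : 0 < q ^ m := by positivity
    linarith
  set A := (Finset.range (K + 1)).image (fun k : ℕ => (k : ℤ)) with hA
  set B := (Finset.range (K + 1)).image (fun k : ℕ => -((k : ℤ) + 1)) with hB
  have hsub : Finset.Icc (-(K : ℤ)) K ⊆ A ∪ B := by
    intro k hk
    rw [Finset.mem_Icc] at hk
    rw [Finset.mem_union, hA, hB, Finset.mem_image, Finset.mem_image]
    rcases le_or_gt 0 k with h | h
    · left; exact ⟨k.natAbs, by rw [Finset.mem_range]; omega, by omega⟩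
    · right; exact ⟨k.natAbs - 1, by rw [Finset.mem_range]; omega, by omega⟩
  have hdisj : Disjoint A B := by
    rw [Finset.disjoint_left]
    intro k hkA hkB
    rw [hA, Finset.mem_image] at hkA
    rw [hB, Finset.mem_image] at hkB
    obtain ⟨a, _, ha⟩ := hkA
    obtain ⟨b, _, hb⟩ := hkB
    omega
  have sA : ∑ k ∈ A, q ^ k.natAbs = ∑ k ∈ Finset.range (K + 1), q ^ k := by
    rw [hA, Finset.sum_image (by intro a _ b _ h; simpa using h)]
    simp
  have sB : ∑ k ∈ B, q ^ k.natAbs = q * ∑ k ∈ Finset.range (K + 1), q ^ k := by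
    rw [hB, Finset.sum_image (by intro a _ b _ h; simpa using h), Finset.mul_sum]
    refine Finset.sum_congr rfl fun k _ => ?_
    have : (-((k : ℤ) + 1)).natAbs = k + 1 := by omega
    rw [this, pow_succ]; ring
  calc _ ≤ ∑ k ∈ A ∪ B, q ^ k.natAbs :=
        Finset.sum_le_sum_of_subset_of_nonneg hsub fun _ _ _ => by positivity
    _ = (1 + q) * ∑ k ∈ Finset.range (K + 1), q ^ k := by
        rw [Finset.sum_union hdisj, sA, sB]; ring
    _ ≤ (1 + q) * (1 / (1 - q)) := by
        have := hgeo (K + 1)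
        gcongr
    _ = _ := by ring

lemma aux_count (ι : Type) [Fintype ι] [DecidableEq ι] (K : ℕ) : ∃ T : Finset (ι → ℤ),
    (∀ z : ι → ℤ, ∑ i, (z i).natAbs ≤ K → z ∈ T) ∧
    ∀ q : ℝ, 0 < q → q < 1 → (T.card : ℝ) * q ^ K ≤ ((1 + q) / (1 - q)) ^ (Fintype.card ι) := by
  refine ⟨(Fintype.piFinset fun _ : ι => Finset.Icc (-(K : ℤ)) K).filter
    (fun z => ∑ i, (z i).natAbs ≤ K), ?_, ?_⟩
  · intro z hz
    rw [Finset.mem_filter, Fintype.mem_piFinset]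
    refine ⟨fun i => ?_, hz⟩
    have := Finset.single_le_sum (f := fun i => (z i).natAbs) (fun _ _ => Nat.zero_le _)
      (Finset.mem_univ i)
    rw [Finset.mem_Icc]
    omega
  · intro q h0 h1
    set T := (Fintype.piFinset fun _ : ι => Finset.Icc (-(K : ℤ)) K).filter
      (fun z => ∑ i, (z i).natAbs ≤ K) with hT
    calc (T.card : ℝ) * q ^ K = ∑ z ∈ T, q ^ K := by rw [Finset.sum_const, nsmul_eq_mul]
      _ ≤ ∑ z ∈ T, ∏ i, q ^ (z i).natAbs := by
          refine Finset.sum_le_sum fun z hz => ?_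
          rw [Finset.prod_pow_eq_pow_sum]
          exact pow_le_pow_of_le_one h0.le h1.le (Finset.mem_filter.mp hz).2
      _ ≤ ∑ z ∈ Fintype.piFinset fun _ : ι => Finset.Icc (-(K : ℤ)) K,
            ∏ i, q ^ (z i).natAbs :=
          Finset.sum_le_sum_of_subset_of_nonneg (Finset.filter_subset _ _)
            fun _ _ _ => by positivity
      _ = ∏ _i : ι, ∑ k ∈ Finset.Icc (-(K : ℤ)) K, q ^ k.natAbs :=
          (Finset.prod_univ_sum (fun _ : ι => Finset.Icc (-(K : ℤ)) K)
            (fun _ k => q ^ k.natAbs)).symm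
      _ ≤ ∏ _i : ι, (1 + q) / (1 - q) :=
          Finset.prod_le_prod (fun _ _ => Finset.sum_nonneg fun _ _ => by positivity)
            fun _ _ => aux_geom K q h0 h1
      _ = _ := by rw [Finset.prod_const, Finset.card_univ]

lemma aux_quant (δ v : ℝ) (hδ : 0 < δ) : ∃ z : ℤ, |v - δ * z| ≤ δ ∧
    (v - δ * z) ^ 2 ≤ δ * |v| ∧ (z.natAbs : ℝ) ≤ |v| / δ := by
  have key : ∀ w : ℝ, 0 ≤ w → ∃ k : ℕ, |w - δ * k| ≤ δ ∧ (w - δ * k) ^ 2 ≤ δ * w ∧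
      (k : ℝ) ≤ w / δ := by
    intro w hw
    refine ⟨⌊w / δ⌋₊, ?_⟩
    have h1 : (⌊w / δ⌋₊ : ℝ) ≤ w / δ := Nat.floor_le (by positivity)
    have h2 : w / δ < ⌊w / δ⌋₊ + 1 := Nat.lt_floor_add_one _
    have h3 : δ * ⌊w / δ⌋₊ ≤ w := by rw [le_div_iff₀ hδ] at h1; linarith
    have h4 : w < δ * ⌊w / δ⌋₊ + δ := by rw [div_lt_iff₀ hδ] at h2; linarith
    have h5 : 0 ≤ δ * (⌊w / δ⌋₊ : ℝ) := by positivity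
    refine ⟨?_, ?_, h1⟩
    · rw [abs_le]; constructor <;> linarith
    · nlinarith
  rcases le_or_gt 0 v with h | h
  · obtain ⟨k, a, b, c⟩ := key v h
    refine ⟨k, ?_, ?_, ?_⟩
    · simpa using a
    · rw [abs_of_nonneg h]; simpa using b
    · rw [abs_of_nonneg h]; simpa using c
  · obtain ⟨k, a, b, c⟩ := key (-v) (by linarith)
    have e : v - δ * ((-(k : ℤ) : ℤ) : ℝ) = -(-v - δ * k) := by push_cast; ring
    refine ⟨-(k : ℤ), ?_, ?_, ?_⟩
    · rw [e, abs_neg]; exact a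
    · rw [e, neg_sq, abs_of_neg h]; exact b
    · rw [abs_of_neg h]; simpa using c

lemma aux_choose_le (x i : ℕ) (B : ℝ) (h : (x : ℝ) ≤ B) : (x.choose i : ℝ) ≤ B ^ i := by
  have h1 : x.choose i ≤ x ^ i := Nat.choose_le_pow x i
  calc (x.choose i : ℝ) ≤ ((x ^ i : ℕ) : ℝ) := by exact_mod_cast h1
    _ = (x : ℝ) ^ i := by push_cast; rfl
    _ ≤ B ^ i := by gcongr

/-- Synthesis operator at a dyadic scale. -/
def auxPsi (r n s : ℕ) (e : ℕ → ℕ → ℝ) : Fin n → ℝ := fun j =>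
  if ((j : ℕ) / 2 ^ s) % 2 = 1 then
    ∑ i ∈ Finset.range r, (((j : ℕ) % 2 ^ s).choose i : ℝ) * e ((j : ℕ) / 2 ^ (s + 1)) i
  else 0

lemma auxPsi_bound (r n s m : ℕ) (hn : n ≤ 2 ^ (s + 1) * m) (e e' : ℕ → ℕ → ℝ) (δ A : ℝ)
    (hδ : 0 < δ)
    (h : ∀ u < m, ∀ i < r, ((2 ^ s) ^ i * (e u i - e' u i)) ^ 2 ≤ δ * ((2 ^ s) ^ i * |e u i|))
    (hA : ∑ u ∈ Finset.range m, ∑ i ∈ Finset.range r, ((2 : ℝ) ^ s) ^ i * |e u i| ≤ A) :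
    sqnorm (auxPsi r n s e - auxPsi r n s e') ≤ 2 ^ (s + 1) * r * δ * A := by
  set H : ℕ → ℝ := fun u => r * ∑ i ∈ Finset.range r, (((2 : ℝ) ^ s) ^ i * (e u i - e' u i)) ^ 2
    with hH
  have hH0 : ∀ u, 0 ≤ H u := fun u => by
    simp only [hH]
    exact mul_nonneg (by positivity) (Finset.sum_nonneg fun _ _ => sq_nonneg _)
  have h1 : ∀ j : Fin n, (auxPsi r n s e - auxPsi r n s e') j ^ 2 ≤ H ((j : ℕ) / 2 ^ (s + 1)) := by
    intro j
    simp only [Pi.sub_apply, auxPsi]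
    split_ifs with hodd
    · rw [← Finset.sum_sub_distrib]
      refine sq_sum_le_card_mul_sum_sq.trans ?_
      simp only [hH, Finset.card_range]
      refine mul_le_mul_of_nonneg_left (Finset.sum_le_sum fun i _ => ?_) (by positivity)
      rw [← mul_sub, mul_pow, mul_pow]
      refine mul_le_mul_of_nonneg_right ?_ (sq_nonneg _)
      refine pow_le_pow_left₀ (by positivity) (aux_choose_le _ _ _ ?_) 2
      have := (Nat.mod_lt (j : ℕ) (show 0 < 2 ^ s by positivity)).le
      exact_mod_cast this
    · simpa using hH0 _
  calc sqnorm (auxPsi r n s e - auxPsi r n s e') ≤ ∑ j : Fin n, H ((j : ℕ) / 2 ^ (s + 1)) :=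
        Finset.sum_le_sum fun j _ => h1 j
    _ = ∑ j ∈ Finset.range n, H (j / 2 ^ (s + 1)) :=
        (Finset.sum_range (fun j => H (j / 2 ^ (s + 1)))).symm
    _ ≤ ∑ j ∈ Finset.range (2 ^ (s + 1) * m), H (j / 2 ^ (s + 1)) :=
        Finset.sum_le_sum_of_subset_of_nonneg (Finset.range_mono hn) fun _ _ _ => hH0 _
    _ = ∑ u ∈ Finset.range m, ∑ v ∈ Finset.range (2 ^ (s + 1)), H u := by
        rw [← aux_sum_blocks _ _ (fun j => H (j / 2 ^ (s + 1)))]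
        refine Finset.sum_congr rfl fun u _ => Finset.sum_congr rfl fun v hv => ?_
        rw [Nat.mul_add_div (by positivity), Nat.div_eq_of_lt (Finset.mem_range.mp hv), add_zero]
    _ = 2 ^ (s + 1) * ∑ u ∈ Finset.range m, H u := by
        rw [Finset.mul_sum]
        refine Finset.sum_congr rfl fun u _ => ?_
        simp
    _ ≤ 2 ^ (s + 1) * ∑ u ∈ Finset.range m,
          (r * δ) * ∑ i ∈ Finset.range r, ((2 : ℝ) ^ s) ^ i * |e u i| := by
        refine mul_le_mul_of_nonneg_left (Finset.sum_le_sum fun u hu => ?_) (by positivity)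
        simp only [hH]
        rw [mul_assoc]
        refine mul_le_mul_of_nonneg_left ?_ (by positivity)
        rw [Finset.mul_sum]
        exact Finset.sum_le_sum fun i hi => h u (Finset.mem_range.mp hu) i (Finset.mem_range.mp hi)
    _ ≤ 2 ^ (s + 1) * ((r * δ) * A) := by
        rw [← Finset.mul_sum]
        gcongr
    _ = _ := by ring

lemma aux_level (r n s m : ℕ) (hn : n ≤ 2 ^ (s + 1) * m) (δ A : ℝ) (hδ : 0 < δ) :
    ∃ T : Finset (Fin n → ℝ),
      (∀ q : ℝ, 0 < q → q < 1 → (T.card : ℝ) * q ^ ⌊A / δ⌋₊ ≤ ((1 + q) / (1 - q)) ^ (m * r)) ∧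
      ∀ e : ℕ → ℕ → ℝ,
        ∑ u ∈ Finset.range m, ∑ i ∈ Finset.range r, ((2 : ℝ) ^ s) ^ i * |e u i| ≤ A →
        ∃ a ∈ T, sqnorm (auxPsi r n s e - a) ≤ 2 ^ (s + 1) * r * δ * A := by
  classical
  obtain ⟨T, hT1, hT2⟩ := aux_count (Fin m × Fin r) ⌊A / δ⌋₊
  set F : (Fin m × Fin r → ℤ) → ℕ → ℕ → ℝ := fun z u i =>
    if h : u < m ∧ i < r then δ * (z (⟨u, h.1⟩, ⟨i, h.2⟩) : ℝ) / (2 ^ s) ^ i else 0 with hF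
  refine ⟨T.image fun z => auxPsi r n s (F z), ?_, ?_⟩
  · intro q h0 h1
    have := hT2 q h0 h1
    simp only [Fintype.card_prod, Fintype.card_fin] at this
    refine le_trans ?_ this
    have hc : ((T.image fun z => auxPsi r n s (F z)).card : ℝ) ≤ T.card := by
      exact_mod_cast Finset.card_image_le
    gcongr
  · intro e he
    choose z hz1 hz2 hz3 using fun (p : Fin m × Fin r) =>
      aux_quant δ ((2 ^ s) ^ (p.2 : ℕ) * e p.1 p.2) hδ
    refine ⟨_, Finset.mem_image_of_mem _ (hT1 z ?_), ?_⟩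
    · apply Nat.le_floor
      push_cast
      calc ∑ p, ((z p).natAbs : ℝ) ≤ ∑ p : Fin m × Fin r, |(2 ^ s) ^ (p.2 : ℕ) * e p.1 p.2| / δ :=
            Finset.sum_le_sum fun p _ => hz3 p
        _ = (∑ u ∈ Finset.range m, ∑ i ∈ Finset.range r, ((2 : ℝ) ^ s) ^ i * |e u i|) / δ := by
            rw [← Finset.sum_div, Fintype.sum_prod_type, Finset.sum_range]
            congr 1
            refine Finset.sum_congr rfl fun u _ => ?_
            rw [Finset.sum_range]
            refine Finset.sum_congr rfl fun i _ => ?_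
            rw [abs_mul, abs_of_nonneg (by positivity)]
        _ ≤ A / δ := by gcongr
    · refine auxPsi_bound r n s m hn e (F z) δ A hδ ?_ he
      intro u hu i hi
      have := hz2 (⟨u, hu⟩, ⟨i, hi⟩)
      simp only at this
      simp only [hF, hu, hi, and_self, dite_true]
      rw [abs_mul, abs_of_nonneg (by positivity : (0 : ℝ) ≤ (2 ^ s) ^ i)] at this
      refine le_of_eq_of_le ?_ this
      have h2 : ((2 : ℝ) ^ s) ^ i ≠ 0 := by positivity
      field_simp

/-! ### Numerical bounds on the level cardinalities -/

lemma aux_log_of_count (N K m : ℕ) (q : ℝ) (h0 : 0 < q) (hN : 0 < N)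
    (h : (N : ℝ) * q ^ K ≤ ((1 + q) / (1 - q)) ^ m) :
    Real.log N ≤ K * (1 / q - 1) + m * Real.log ((1 + q) / (1 - q)) ∧
    Real.log N ≤ K * (-Real.log q) + m * Real.log ((1 + q) / (1 - q)) := by
  have hN' : (0 : ℝ) < N := by exact_mod_cast hN
  have h2 := Real.log_le_log (by positivity) h
  rw [Real.log_mul hN'.ne' (by positivity), Real.log_pow, Real.log_pow] at h2
  have h3 : -Real.log q ≤ 1 / q - 1 := by
    rw [← Real.log_inv, one_div]
    exact Real.log_le_sub_one_of_pos (by positivity)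
  have h4 : (K : ℝ) * (-Real.log q) ≤ K * (1 / q - 1) :=
    mul_le_mul_of_nonneg_left h3 (by positivity)
  constructor <;> linarith

lemma aux_poly_geom1 (d : ℕ) : ((d : ℝ) + 1) * (32 / 49) ^ d ≤ 8 * (3 / 4) ^ d := by
  have h := one_add_mul_le_pow (a := (19 / 128 : ℝ)) (by norm_num) d
  have h2 : ((d : ℝ) + 1) ≤ 8 * (147 / 128) ^ d := by
    have : (1 + 19 / 128 : ℝ) = 147 / 128 := by norm_num
    rw [this] at h
    have : (0 : ℝ) ≤ d := by positivity
    linarith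
  calc _ ≤ (8 * (147 / 128) ^ d) * (32 / 49 : ℝ) ^ d := by gcongr
    _ = 8 * (3 / 4) ^ d := by rw [mul_assoc, ← mul_pow]; norm_num

lemma aux_poly_geom2 (d : ℕ) : ((d : ℝ) + 1) ≤ 2 * (3 / 4) ^ d * 2 ^ d := by
  have h := one_add_mul_le_pow (a := (1 / 2 : ℝ)) (by norm_num) d
  rw [mul_assoc, ← mul_pow]
  have e : (1 + 1 / 2 : ℝ) = 3 / 4 * 2 := by norm_num
  rw [e] at h
  have : (0 : ℝ) ≤ d := by positivity
  linarith

lemma aux_logcount (r : ℕ) (hr : 1 ≤ r) (c0 : ℝ) (hc0 : 0 ≤ c0) : ∃ C1 : ℝ, 0 < C1 ∧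
    ∀ l l0 N K : ℕ, 0 < N →
      (∀ q : ℝ, 0 < q → q < 1 → (N : ℝ) * q ^ K ≤ ((1 + q) / (1 - q)) ^ (2 ^ l * r)) →
      (K : ℝ) * ((2 : ℝ) ^ l) ^ (2 * r) * ((7 / 8) ^ ((l - l0) + (l0 - l))) ^ 2 ≤
        c0 * 2 ^ l * ((2 : ℝ) ^ l0) ^ (2 * r) →
      Real.log N ≤ C1 * 2 ^ l0 * (3 / 4) ^ ((l - l0) + (l0 - l)) := by
  have hrR : (1 : ℝ) ≤ r := by exact_mod_cast hr
  set B : ℝ := 2 ^ (2 * r + 1) with hB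
  have hB1 : 1 ≤ B := one_le_pow₀ (by norm_num)
  set C' : ℝ := 1 + r * (Real.log (4 * (1 + c0)) + Real.log B) with hC'
  have hlog1 : 0 ≤ Real.log (4 * (1 + c0)) := Real.log_nonneg (by linarith)
  have hlog2 : 0 ≤ Real.log B := Real.log_nonneg hB1
  have hC'0 : 0 < C' := by positivity
  refine ⟨24 * c0 + r + 2 * C', by positivity, ?_⟩
  intro l l0 N K hN hq hK
  rcases le_total l0 l with hl | hl
  · obtain ⟨d, rfl⟩ := Nat.exists_eq_add_of_le hl
    have e1 : (l0 + d - l0) + (l0 - (l0 + d)) = d := by omega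
    rw [e1] at hK ⊢
    have hKb : (K : ℝ) ≤ c0 * 2 ^ l0 * (32 / 49) ^ d := by
      have hp : (0 : ℝ) < (2 ^ l0) ^ (2 * r) := by positivity
      have h4 : (4 : ℝ) ^ d ≤ (2 ^ d) ^ (2 * r) := by
        rw [← pow_mul, show (4 : ℝ) = 2 ^ 2 by norm_num, ← pow_mul]
        exact pow_le_pow_right₀ (by norm_num) (by nlinarith)
      have h5 : (K : ℝ) * (2 ^ d) ^ (2 * r) * ((7 / 8) ^ d) ^ 2 ≤ c0 * 2 ^ l0 * 2 ^ d := by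
        rw [pow_add, mul_pow] at hK
        refine le_of_mul_le_mul_right ?_ hp
        calc _ = (K : ℝ) * ((2 ^ l0) ^ (2 * r) * (2 ^ d) ^ (2 * r)) * ((7 / 8) ^ d) ^ 2 := by ring
          _ ≤ _ := hK
          _ = _ := by ring
      have h6 : (K : ℝ) * 4 ^ d * ((7 / 8) ^ d) ^ 2 ≤ c0 * 2 ^ l0 * 2 ^ d := by
        refine le_trans ?_ h5
        gcongr
      have h7 : (0 : ℝ) < (49 / 16) ^ d := by positivity
      refine le_of_mul_le_mul_right ?_ h7
      calc (K : ℝ) * (49 / 16) ^ d = (K : ℝ) * 4 ^ d * ((7 / 8) ^ d) ^ 2 := by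
            rw [← pow_mul, mul_comm d 2, pow_mul, mul_assoc, ← mul_pow]; norm_num
        _ ≤ _ := h6
        _ = _ := by rw [mul_assoc _ ((32 / 49 : ℝ) ^ d), ← mul_pow]; norm_num
    set q : ℝ := (1 / 4) ^ (d + 1) with hqd
    have hq0 : 0 < q := by positivity
    have hq4 : q ≤ 1 / 4 := by
      rw [hqd, pow_succ]
      have : (1 / 4 : ℝ) ^ d ≤ 1 := pow_le_one₀ (by norm_num) (by norm_num)
      linarith
    have hmain := (aux_log_of_count N K _ q hq0 hN (hq q hq0 (by linarith))).2
    have hl1 : -Real.log q ≤ 3 * (d + 1) := by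
      rw [hqd, Real.log_pow, one_div, Real.log_inv]
      have : Real.log 4 ≤ 4 - 1 := Real.log_le_sub_one_of_pos (by norm_num)
      push_cast
      nlinarith [(by positivity : (0 : ℝ) ≤ d)]
    have hl2 : Real.log ((1 + q) / (1 - q)) ≤ (1 / 4) ^ d := by
      have hp : 0 < 1 - q := by linarith
      refine (Real.log_le_sub_one_of_pos (by positivity)).trans ?_
      have : (1 / 4 : ℝ) ^ d = 4 * q := by rw [hqd, pow_succ]; ring
      rw [this, sub_le_iff_le_add, div_le_iff₀ hp]
      nlinarith
    calc Real.log N ≤ _ := hmain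
      _ ≤ (c0 * 2 ^ l0 * (32 / 49) ^ d) * (3 * (d + 1)) +
          ((2 ^ (l0 + d) * r : ℕ) : ℝ) * (1 / 4) ^ d := by
          have : 0 ≤ -Real.log q := by
            have := Real.log_nonpos hq0.le (by linarith); linarith
          gcongr
      _ = 3 * c0 * 2 ^ l0 * ((d + 1) * (32 / 49) ^ d) + r * 2 ^ l0 * (1 / 2) ^ d := by
          push_cast
          have : (1 / 2 : ℝ) ^ d = 2 ^ d * (1 / 4) ^ d := by rw [← mul_pow]; norm_num
          rw [this, pow_add]; ring
      _ ≤ 3 * c0 * 2 ^ l0 * (8 * (3 / 4) ^ d) + r * 2 ^ l0 * (3 / 4) ^ d := by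
          have h1 := aux_poly_geom1 d
          have h2 : (1 / 2 : ℝ) ^ d ≤ (3 / 4) ^ d :=
            pow_le_pow_left₀ (by norm_num) (by norm_num) d
          gcongr
      _ ≤ _ := by
          have : 0 ≤ 2 * C' * 2 ^ l0 * (3 / 4 : ℝ) ^ d := by positivity
          linarith
  · obtain ⟨d, rfl⟩ := Nat.exists_eq_add_of_le hl
    have e1 : (l - (l + d)) + (l + d - l) = d := by omega
    rw [e1] at hK ⊢
    set G : ℝ := (1 + c0) * B ^ d with hG
    have hBd : 1 ≤ B ^ d := one_le_pow₀ hB1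
    have hG1 : 1 ≤ G := by nlinarith
    have hKb : (K : ℝ) ≤ 2 ^ l * G := by
      have hp : (0 : ℝ) < (2 ^ l) ^ (2 * r) := by positivity
      have h5 : (K : ℝ) * ((7 / 8) ^ d) ^ 2 ≤ c0 * 2 ^ l * (2 ^ d) ^ (2 * r) := by
        rw [pow_add, mul_pow] at hK
        refine le_of_mul_le_mul_right ?_ hp
        calc _ = (K : ℝ) * (2 ^ l) ^ (2 * r) * ((7 / 8) ^ d) ^ 2 := by ring
          _ ≤ _ := hK
          _ = _ := by ring
      have h6 : (1 / 2 : ℝ) ^ d ≤ ((7 / 8) ^ d) ^ 2 := by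
        rw [← pow_mul, mul_comm d 2, pow_mul]; gcongr; norm_num
      have h7 : (0 : ℝ) < (1 / 2) ^ d := by positivity
      refine le_of_mul_le_mul_right ?_ h7
      calc (K : ℝ) * (1 / 2) ^ d ≤ K * ((7 / 8) ^ d) ^ 2 := by gcongr
        _ ≤ c0 * 2 ^ l * (2 ^ d) ^ (2 * r) := h5
        _ ≤ (1 + c0) * 2 ^ l * (2 ^ d) ^ (2 * r) := by gcongr; linarith
        _ = _ := by
          rw [hG, hB, pow_succ, mul_pow (2 ^ (2 * r)) 2 d]
          have : (2 : ℝ) ^ d * (1 / 2) ^ d = 1 := by rw [← mul_pow]; norm_num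
          rw [← pow_mul, ← pow_mul, mul_comm d (2 * r)]
          linear_combination (-(1 + c0) * 2 ^ l * 2 ^ (2 * r * d)) * this
    set q : ℝ := 1 - 1 / (2 * G) with hqd
    have hGi : 1 / (2 * G) ≤ 1 / 2 := by
      rw [div_le_div_iff₀ (by positivity) (by norm_num)]; linarith
    have hGp : 0 < 1 / (2 * G) := by positivity
    have hq0 : 1 / 2 ≤ q := by linarith
    have hq1 : q < 1 := by linarith
    have hmain := (aux_log_of_count N K _ q (by linarith) hN (hq q (by linarith) hq1)).1
    have hl1 : 1 / q - 1 ≤ 1 / G := by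
      rw [sub_le_iff_le_add, div_le_iff₀ (by linarith)]
      have : 1 / (2 * G) = (1 / G) / 2 := by field_simp
      rw [this] at hqd
      have h1G : 1 / G ≤ 1 := by rw [div_le_one (by positivity)]; exact hG1
      have : 0 < 1 / G := by positivity
      rw [hqd]
      nlinarith
    have hl2 : Real.log ((1 + q) / (1 - q)) ≤ Real.log (4 * (1 + c0)) + d * Real.log B := by
      rw [← Real.log_pow, ← Real.log_mul (by positivity) (by positivity)]
      have hp : 0 < 1 - q := by linarith
      refine Real.log_le_log (div_pos (by linarith) hp) ?_
      rw [div_le_iff₀ hp]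
      have : 1 - q = 1 / (2 * G) := by rw [hqd]; ring
      rw [this, mul_assoc 4 (1 + c0), ← hG]
      have : 4 * G * (1 / (2 * G)) = 2 := by field_simp; norm_num
      linarith
    have hd0 : (0 : ℝ) ≤ d := by positivity
    calc Real.log N ≤ _ := hmain
      _ ≤ (2 ^ l * G) * (1 / G) + ((2 ^ l * r : ℕ) : ℝ) *
          (Real.log (4 * (1 + c0)) + d * Real.log B) := by
          have : 0 ≤ 1 / q - 1 := by
            rw [sub_nonneg, le_div_iff₀ (by linarith)]; linarith
          gcongr
      _ = 2 ^ l * (1 + r * (Real.log (4 * (1 + c0)) + d * Real.log B)) := by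
          push_cast; field_simp
      _ ≤ 2 ^ l * ((d + 1) * C') := by
          refine mul_le_mul_of_nonneg_left ?_ (by positivity)
          have h1 : 0 ≤ d * (r * Real.log (4 * (1 + c0))) := by positivity
          have h2 : 0 ≤ r * Real.log B := by positivity
          rw [hC']
          nlinarith
      _ ≤ 2 ^ l * ((2 * (3 / 4) ^ d * 2 ^ d) * C') := by
          have := aux_poly_geom2 d
          gcongr
      _ = 2 * C' * 2 ^ (l + d) * (3 / 4) ^ d := by rw [pow_add]; ring
      _ ≤ _ := by
          have : 0 ≤ (24 * c0 + r) * 2 ^ (l + d) * (3 / 4 : ℝ) ^ d := by positivity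
          linarith

lemma aux_two_sided (ρ : ℝ) (h0 : 0 < ρ) (h1 : ρ < 1) (l0 L : ℕ) :
    ∑ l ∈ Finset.range L, ρ ^ ((l - l0) + (l0 - l)) ≤ 2 / (1 - ρ) := by
  have hp : 0 < 1 - ρ := by linarith
  have hgeo : ∀ m : ℕ, ∑ k ∈ Finset.range m, ρ ^ k ≤ 1 / (1 - ρ) := by
    intro m
    rw [geom_sum_eq h1.ne, ← neg_div_neg_eq, neg_sub, neg_sub]
    gcongr
    have : 0 < ρ ^ m := by positivity
    linarith
  calc _ ≤ ∑ l ∈ Finset.range (l0 + 1 + L), ρ ^ ((l - l0) + (l0 - l)) :=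
        Finset.sum_le_sum_of_subset_of_nonneg (Finset.range_mono (by omega))
          fun _ _ _ => by positivity
    _ = ∑ l ∈ Finset.range (l0 + 1), ρ ^ ((l - l0) + (l0 - l)) +
        ∑ k ∈ Finset.range L, ρ ^ ((l0 + 1 + k - l0) + (l0 - (l0 + 1 + k))) := by
        rw [Finset.sum_range_add]
    _ ≤ ∑ k ∈ Finset.range (l0 + 1), ρ ^ k + ∑ k ∈ Finset.range L, ρ ^ k := by
        refine add_le_add (le_of_eq ?_) (Finset.sum_le_sum fun k _ => ?_)
        · rw [← Finset.sum_range_reflect]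
          refine Finset.sum_congr rfl fun l hl => ?_
          have := Finset.mem_range.mp hl
          congr 1; omega
        · exact pow_le_pow_of_le_one h0.le h1.le (by omega)
    _ ≤ 1 / (1 - ρ) + 1 / (1 - ρ) := add_le_add (hgeo _) (hgeo _)
    _ = _ := by ring

/-! ### Euclidean norm and covering numbers -/

lemma aux_eunorm_eq {n : ℕ} (x : Fin n → ℝ) : eunorm x = ‖WithLp.toLp 2 x‖ := by
  rw [EuclideanSpace.norm_eq]
  simp [eunorm, sqnorm]

lemma aux_eunorm_add {n : ℕ} (x y : Fin n → ℝ) : eunorm (x + y) ≤ eunorm x + eunorm y := by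
  simp only [aux_eunorm_eq, WithLp.toLp_add]
  exact norm_add_le _ _

lemma aux_eunorm_sum {n : ℕ} {ι : Type} (s : Finset ι) (x : ι → Fin n → ℝ) :
    eunorm (∑ l ∈ s, x l) ≤ ∑ l ∈ s, eunorm (x l) := by
  classical
  induction s using Finset.induction_on with
  | empty => simp [eunorm, sqnorm]
  | insert a s ha ih =>
    rw [Finset.sum_insert ha, Finset.sum_insert ha]
    exact (aux_eunorm_add _ _).trans (by linarith)

lemma aux_eunorm_le {n : ℕ} (x : Fin n → ℝ) (b : ℝ) (hb : 0 ≤ b) (h : sqnorm x ≤ b ^ 2) :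
    eunorm x ≤ b := by
  unfold eunorm
  rw [← Real.sqrt_sq hb]
  exact Real.sqrt_le_sqrt h

lemma aux_covN {n : ℕ} (ε : ℝ) (K : Set (Fin n → ℝ)) (T : Finset (Fin n → ℝ))
    (h : ∀ x ∈ K, ∃ a ∈ T, eunorm (x - a) ≤ ε) : covN ε K ≤ T.card := by
  refine Nat.sInf_le ⟨fun i => (T.equivFin.symm i : Fin n → ℝ), fun x hx => ?_⟩
  obtain ⟨a, ha, hd⟩ := h x hx
  refine ⟨T.equivFin ⟨a, ha⟩, ?_⟩
  simpa using hd

/-- Covering of the polynomial part. -/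
lemma aux_base (r n : ℕ) (hr : 1 ≤ r) (hn : r ≤ n) (t ε : ℝ) (ht : 0 < t) (hε : 0 < ε) :
    ∃ T : Finset (Fin n → ℝ), 0 < T.card ∧
      Real.log T.card ≤ r * Real.log (4 * r) +
        r * Real.log (2 + 2 ^ r * (n : ℝ) ^ r * t / (ε * Real.sqrt n)) ∧
      ∀ c : ℕ → ℝ, (∀ i < r, |c i| ≤ 2 ^ i * t) → ∃ a ∈ T,
        eunorm ((fun j : Fin n => ∑ i ∈ Finset.range r, (((j : ℕ).choose i : ℕ) : ℝ) * c i) - a)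
          ≤ ε / 2 := by
  classical
  have hrR : (1 : ℝ) ≤ r := by exact_mod_cast hr
  have hnR : (1 : ℝ) ≤ n := by exact_mod_cast hr.trans hn
  have hn0 : (0 : ℝ) < n := by linarith
  have hsq : 0 < Real.sqrt n := Real.sqrt_pos.mpr hn0
  have hss : Real.sqrt n * Real.sqrt n = n := Real.mul_self_sqrt hn0.le
  set Q : ℝ := 2 ^ r * (n : ℝ) ^ r * t / (ε * Real.sqrt n) with hQ
  have hQ0 : 0 < Q := by positivity
  set δ : ℕ → ℝ := fun i => ε / (2 * r * Real.sqrt n * (n : ℝ) ^ i) with hδ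
  have hδ0 : ∀ i, 0 < δ i := fun i => by simp only [hδ]; positivity
  set Kf : ℕ → ℕ := fun i => ⌊2 ^ i * t / δ i⌋₊ with hKf
  have hKb : ∀ i < r, ((2 * Kf i + 1 : ℕ) : ℝ) ≤ 4 * r * (2 + Q) := by
    intro i hi
    have h1 : (Kf i : ℝ) ≤ 2 ^ i * t / δ i := Nat.floor_le (by have := hδ0 i; positivity)
    have h2 : 2 ^ i * t / δ i = 2 * r * ((2 ^ i * (n : ℝ) ^ (i + 1)) * t / (ε * Real.sqrt n)) := by
      simp only [hδ]
      rw [pow_succ (n : ℝ) i]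
      field_simp
      rw [sq, hss]
    have h3 : (2 ^ i * (n : ℝ) ^ (i + 1)) * t / (ε * Real.sqrt n) ≤ Q := by
      rw [hQ]
      have a1 : (2 : ℝ) ^ i ≤ 2 ^ r := pow_le_pow_right₀ (by norm_num) hi.le
      have a2 : (n : ℝ) ^ (i + 1) ≤ (n : ℝ) ^ r := pow_le_pow_right₀ hnR hi
      gcongr
    rw [h2] at h1
    push_cast
    have h4 : 2 * (r : ℝ) * ((2 ^ i * (n : ℝ) ^ (i + 1)) * t / (ε * Real.sqrt n)) ≤ 2 * r * Q := by
      gcongr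
    nlinarith
  set cen : (Fin r → ℤ) → Fin n → ℝ := fun z j =>
    ∑ i : Fin r, (((j : ℕ).choose i : ℕ) : ℝ) * (δ i * z i) with hcen
  set T0 : Finset (Fin r → ℤ) :=
    Fintype.piFinset fun i : Fin r => Finset.Icc (-(Kf i : ℤ)) (Kf i) with hT0
  have hcov : ∀ c : ℕ → ℝ, (∀ i < r, |c i| ≤ 2 ^ i * t) → ∃ a ∈ T0.image cen,
        eunorm ((fun j : Fin n => ∑ i ∈ Finset.range r, (((j : ℕ).choose i : ℕ) : ℝ) * c i) - a)
          ≤ ε / 2 := by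
    intro c hc
    choose z hz1 hz2 hz3 using fun i : Fin r => aux_quant (δ i) (c i) (hδ0 i)
    refine ⟨cen z, Finset.mem_image_of_mem _ ?_, ?_⟩
    · rw [hT0, Fintype.mem_piFinset]
      intro i
      have : (z i).natAbs ≤ Kf i := by
        apply Nat.le_floor
        refine (hz3 i).trans ?_
        have := hδ0 i
        have := hc i i.2
        gcongr
      rw [Finset.mem_Icc]
      omega
    · refine aux_eunorm_le _ _ (by positivity) ?_
      have hpt : ∀ j : Fin n, ((fun j : Fin n => ∑ i ∈ Finset.range r,
          (((j : ℕ).choose i : ℕ) : ℝ) * c i) - cen z) j ^ 2 ≤ (ε / (2 * Real.sqrt n)) ^ 2 := by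
        intro j
        rw [sq_le_sq, abs_of_nonneg (by positivity : 0 ≤ ε / (2 * Real.sqrt n))]
        simp only [Pi.sub_apply, hcen, Finset.sum_range]
        rw [← Finset.sum_sub_distrib]
        refine (Finset.abs_sum_le_sum_abs _ _).trans ?_
        calc _ ≤ ∑ i : Fin r, ε / (2 * r * Real.sqrt n) := by
              refine Finset.sum_le_sum fun i _ => ?_
              rw [← mul_sub, abs_mul, abs_of_nonneg (by positivity)]
              have hch : (((j : ℕ).choose i : ℕ) : ℝ) ≤ (n : ℝ) ^ (i : ℕ) :=
                aux_choose_le _ _ _ (by exact_mod_cast j.2.le)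
              calc _ ≤ (n : ℝ) ^ (i : ℕ) * δ i :=
                    mul_le_mul hch (hz1 i) (abs_nonneg _) (by positivity)
                _ = _ := by simp only [hδ]; field_simp
          _ = _ := by
              rw [Finset.sum_const, Finset.card_univ, Fintype.card_fin, nsmul_eq_mul]
              field_simp
      calc sqnorm _ ≤ ∑ _j : Fin n, (ε / (2 * Real.sqrt n)) ^ 2 :=
            Finset.sum_le_sum fun j _ => hpt j
        _ = (ε / 2) ^ 2 := by
            rw [Finset.sum_const, Finset.card_univ, Fintype.card_fin, nsmul_eq_mul, div_pow,
              mul_pow, Real.sq_sqrt hn0.le]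
            field_simp
  have hpos : 0 < (T0.image cen).card := by
    obtain ⟨a, ha, _⟩ := hcov 0 (fun i _ => by simp; positivity)
    exact Finset.card_pos.mpr ⟨a, ha⟩
  refine ⟨T0.image cen, hpos, ?_, hcov⟩
  have hcard : ((T0.image cen).card : ℝ) ≤ (4 * r * (2 + Q)) ^ r := by
    calc ((T0.image cen).card : ℝ) ≤ T0.card := by exact_mod_cast Finset.card_image_le
      _ = ∏ i : Fin r, ((2 * Kf i + 1 : ℕ) : ℝ) := by
          rw [hT0, Fintype.card_piFinset, Nat.cast_prod]
          refine Finset.prod_congr rfl fun i _ => ?_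
          rw [Int.card_Icc]
          congr 1
          omega
      _ ≤ ∏ _i : Fin r, 4 * r * (2 + Q) :=
          Finset.prod_le_prod (fun _ _ => by positivity) fun i _ => hKb i i.2
      _ = _ := by rw [Finset.prod_const, Finset.card_univ, Fintype.card_fin]
  have := Real.log_le_log (by exact_mod_cast hpos) hcard
  rw [Real.log_pow, Real.log_mul (by positivity) (by positivity)] at this
  linarith

/-- Covering of one dyadic level. -/
lemma aux_level_cover (r : ℕ) (hr : 1 ≤ r) : ∃ C1 : ℝ, 0 < C1 ∧
    ∀ (n L l l0 : ℕ) (V ε : ℝ), 0 < V → 0 < ε → l < L → n ≤ 2 ^ L → 2 ^ (L - 1) ≤ n →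
      V * Real.sqrt n / ε ≤ ((2 : ℝ) ^ l0) ^ r →
      ∃ T : Finset (Fin n → ℝ), 0 < T.card ∧
        Real.log T.card ≤ C1 * 2 ^ l0 * (3 / 4) ^ ((l - l0) + (l0 - l)) ∧
        ∀ f : ℕ → ℝ, (∀ X, ∑ k ∈ Finset.range X, |dseq^[r] f k| ≤ V * (n / (n : ℝ) ^ r)) →
          ∃ a ∈ T, eunorm ((fun j : Fin n => auxP r f (L - 1 - l) j - auxP r f (L - 1 - l + 1) j) - a)
            ≤ ε / 32 * (7 / 8) ^ ((l - l0) + (l0 - l)) := by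
  have hrR : (1 : ℝ) ≤ r := by exact_mod_cast hr
  obtain ⟨C1, hC1, hlogc⟩ := aux_logcount r hr (2048 * r ^ 3) (by positivity)
  refine ⟨C1, hC1, ?_⟩
  intro n L l l0 V ε hV hε hl hnL hLn hX
  set s := L - 1 - l with hs
  set D := (l - l0) + (l0 - l) with hD
  have hn0 : 0 < n := lt_of_lt_of_le (by positivity) hLn
  have hnR : (0 : ℝ) < n := by exact_mod_cast hn0
  have hsl : (2 : ℝ) ^ s * 2 ^ l ≤ n := by
    rw [← pow_add]
    have : s + l = L - 1 := by omega
    rw [this]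
    exact_mod_cast hLn
  have hnm : n ≤ 2 ^ (s + 1) * 2 ^ l := by
    rw [← pow_add]
    have : s + 1 + l = L := by omega
    rw [this]; exact hnL
  set W : ℝ := V * (n / (n : ℝ) ^ r) with hW
  have hW0 : 0 < W := by positivity
  set w : ℝ := (7 / 8 : ℝ) ^ D with hw
  have hw0 : 0 < w := by positivity
  set δ : ℝ := ε ^ 2 * w ^ 2 * ((2 : ℝ) ^ l) ^ r / (2048 * r ^ 2 * V * n) with hδ
  have hδ0 : 0 < δ := by positivity
  set A : ℝ := r * ((2 : ℝ) ^ s) ^ (r - 1) * W with hA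
  have hA0 : 0 < A := by positivity
  obtain ⟨T, hT1, hT2⟩ := aux_level r n s (2 ^ l) hnm δ A hδ0
  have herr : 2 ^ (s + 1) * r * δ * A ≤ (ε / 32 * w) ^ 2 := by
    have h1 : ((2 : ℝ) ^ s * 2 ^ l) ^ r ≤ (n : ℝ) ^ r := by gcongr
    have hpow : ((2 : ℝ) ^ s) ^ r = (2 ^ s) ^ (r - 1) * 2 ^ s := by
      rw [← pow_succ]; congr 1; omega
    have h2 : 2 ^ (s + 1) * r * δ * A =
        (((2 : ℝ) ^ s * 2 ^ l) ^ r / (n : ℝ) ^ r) * (ε / 32 * w) ^ 2 := by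
      rw [hA, hδ, hW, mul_pow, hpow, pow_succ 2 s]
      field_simp
      norm_num
    rw [h2]
    have h3 : ((2 : ℝ) ^ s * 2 ^ l) ^ r / (n : ℝ) ^ r ≤ 1 := by
      rw [div_le_one (by positivity)]; exact h1
    exact mul_le_of_le_one_left (by positivity) h3
  have hcov : ∀ f : ℕ → ℝ, (∀ X, ∑ k ∈ Finset.range X, |dseq^[r] f k| ≤ W) →
      ∃ a ∈ T, eunorm ((fun j : Fin n => auxP r f s j - auxP r f (s + 1) j) - a)
        ≤ ε / 32 * w := by
    intro f hf
    have hsum : ∑ u ∈ Finset.range (2 ^ l), ∑ i ∈ Finset.range r,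
        ((2 : ℝ) ^ s) ^ i * |auxE r f s u i| ≤ A := by
      rw [Finset.sum_comm]
      calc _ ≤ ∑ i ∈ Finset.range r, ((2 : ℝ) ^ s) ^ (r - 1) * W := by
            refine Finset.sum_le_sum fun i hi => ?_
            have hi' := Finset.mem_range.mp hi
            rw [← Finset.mul_sum]
            calc _ ≤ ((2 : ℝ) ^ s) ^ i * (((2 : ℝ) ^ s) ^ (r - 1 - i) * W) :=
                  mul_le_mul_of_nonneg_left (auxE_sum r f s (2 ^ l) i hi' W hf) (by positivity)
              _ = _ := by
                  rw [← mul_assoc, ← pow_add]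
                  congr 2; omega
        _ = A := by
            rw [Finset.sum_const, Finset.card_range, nsmul_eq_mul, hA, mul_assoc]
    obtain ⟨a, ha, hb⟩ := hT2 (auxE r f s) hsum
    refine ⟨a, ha, aux_eunorm_le _ _ (by positivity) ?_⟩
    have : (fun j : Fin n => auxP r f s j - auxP r f (s + 1) j) = auxPsi r n s (auxE r f s) := by
      funext j
      rw [auxP_diff]
      rfl
    rw [this]
    exact hb.trans herr
  have hpos : 0 < T.card := by
    obtain ⟨a, ha, _⟩ := hT2 0 (by simp; exact hA0.le)
    exact Finset.card_pos.mpr ⟨a, ha⟩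
  refine ⟨T, hpos, hlogc l l0 T.card ⌊A / δ⌋₊ hpos hT1 ?_, hcov⟩
  have hfl : (⌊A / δ⌋₊ : ℝ) ≤ A / δ := Nat.floor_le (by positivity)
  have hpow : ∀ x : ℝ, x ^ r = x ^ (r - 1) * x := by
    intro x; rw [← pow_succ]; congr 1; omega
  have h2 : A / δ * ((2 : ℝ) ^ l) ^ (2 * r) * w ^ 2 =
      2048 * r ^ 3 * 2 ^ l * (V ^ 2 * n / ε ^ 2) *
        (((2 : ℝ) ^ s * 2 ^ l) ^ (r - 1) / (n : ℝ) ^ (r - 1)) := by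
    rw [hA, hδ, hW, mul_pow, two_mul r, pow_add, hpow (2 ^ l), hpow (n : ℝ)]
    field_simp
  have h3 : ((2 : ℝ) ^ s * 2 ^ l) ^ (r - 1) / (n : ℝ) ^ (r - 1) ≤ 1 := by
    rw [div_le_one (by positivity)]; gcongr
  have h4 : V ^ 2 * n / ε ^ 2 ≤ ((2 : ℝ) ^ l0) ^ (2 * r) := by
    have e1 : V ^ 2 * n / ε ^ 2 = (V * Real.sqrt n / ε) ^ 2 := by
      rw [div_pow, mul_pow, Real.sq_sqrt hnR.le]
    rw [e1, mul_comm 2 r, pow_mul]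
    gcongr
  calc _ ≤ A / δ * ((2 : ℝ) ^ l) ^ (2 * r) * w ^ 2 := by gcongr
    _ = _ := h2
    _ ≤ 2048 * r ^ 3 * 2 ^ l * (V ^ 2 * n / ε ^ 2) := mul_le_of_le_one_right (by positivity) h3
    _ ≤ _ := by gcongr

lemma aux_l0 (Y : ℝ) (hY : 0 < Y) : ∃ l0 : ℕ, Y ≤ 2 ^ l0 ∧ (2 : ℝ) ^ l0 ≤ 2 * Y + 1 := by
  rcases le_or_gt Y 1 with h | h
  · exact ⟨0, by simpa using h, by simp; linarith⟩
  · obtain ⟨k, h1, h2⟩ := exists_nat_pow_near h.le (by norm_num : (1 : ℝ) < 2)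
    exact ⟨k + 1, h2.le, by rw [pow_succ]; linarith⟩

set_option maxHeartbeats 1000000 in
/-- Theorem: metric entropy bound for
`S_r(V, t) = {θ : ‖θ‖ ≤ t, ‖D^{(r)}θ‖₁ ≤ V n^{1-r}}`. -/
theorem stmt14 (r : ℕ) (hr : 1 ≤ r) :
    ∃ C : ℝ, 0 < C ∧
      ∀ (n : ℕ), r ≤ n → ∀ t : ℝ, 0 < t → ∀ V : ℝ, 0 < V → ∀ ε : ℝ, 0 < ε →
        Real.log (covN ε
            {θ : Fin n → ℝ | eunorm θ ≤ t ∧ Dl1 r θ ≤ V * (n : ℝ) ^ (1 - (r : ℤ))}) ≤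
          C * (V * Real.sqrt (n : ℝ) / ε) ^ ((1 : ℝ) / (r : ℝ)) +
            (r : ℝ) * Real.log (2 + 2 ^ r * (n : ℝ) ^ r * t / (ε * Real.sqrt (n : ℝ))) +
            C := by
  classical
  obtain ⟨C1, hC1, hlev⟩ := aux_level_cover r hr
  have hrR : (1 : ℝ) ≤ r := by exact_mod_cast hr
  have hlr : 0 ≤ Real.log (4 * r) := Real.log_nonneg (by linarith)
  refine ⟨16 * C1 + r * Real.log (4 * r), by positivity, ?_⟩
  intro n hn t ht V hV ε hε
  have hn1 : 1 ≤ n := hr.trans hn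
  have hnR : (0 : ℝ) < n := by exact_mod_cast hn1
  set X : ℝ := V * Real.sqrt n / ε with hX
  have hX0 : 0 < X := by have := Real.sqrt_pos.mpr hnR; positivity
  set Y : ℝ := X ^ ((1 : ℝ) / (r : ℝ)) with hY
  have hY0 : 0 < Y := Real.rpow_pos_of_pos hX0 _
  have hYX : Y ^ r = X := by
    rw [hY, one_div]
    exact Real.rpow_inv_natCast_pow hX0.le (by omega)
  obtain ⟨l0, hl1, hl2⟩ := aux_l0 Y hY0
  have hXl : X ≤ ((2 : ℝ) ^ l0) ^ r := by rw [← hYX]; gcongr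
  set L := Nat.clog 2 n with hL
  have hnL : n ≤ 2 ^ L := Nat.le_pow_clog (by norm_num) n
  have hLn : 2 ^ (L - 1) ≤ n := by
    rcases Nat.lt_or_ge 1 n with h | h
    · exact (Nat.pow_pred_clog_lt_self (by norm_num) h).le
    · have : n = 1 := by omega
      rw [hL, this]; simp
  have hlev' := fun l : Fin L => hlev n L l l0 V ε hV hε l.2 hnL hLn hXl
  choose T hTpos hTlog hTcov using hlev'
  obtain ⟨T0, hT0pos, hT0log, hT0cov⟩ := aux_base r n hr hn t ε ht hε
  set U : Finset (Fin n → ℝ) := (T0 ×ˢ Fintype.piFinset T).image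
    (fun p => p.1 + ∑ l, p.2 l) with hU
  have hcov : ∀ θ ∈ {θ : Fin n → ℝ | eunorm θ ≤ t ∧ Dl1 r θ ≤ V * (n : ℝ) ^ (1 - (r : ℤ))},
      ∃ a ∈ U, eunorm (θ - a) ≤ ε := by
    rintro θ ⟨hθ1, hθ2⟩
    obtain ⟨f, hf1, hf2⟩ := aux_ext r (pad θ) n hn
    have hfW : ∀ X, ∑ k ∈ Finset.range X, |dseq^[r] f k| ≤ V * (n / (n : ℝ) ^ r) := by
      intro X
      have e : V * (n : ℝ) ^ (1 - (r : ℤ)) = V * (n / (n : ℝ) ^ r) := by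
        rw [zpow_sub₀ hnR.ne', zpow_one, zpow_natCast]
      rw [← e]
      refine le_trans ?_ hθ2
      unfold Dl1 DD
      have e2 : ∑ k ∈ Finset.range (n - r), |dseq^[r] (pad θ) k| =
          ∑ k ∈ Finset.range (n - r), |dseq^[r] f k| := by
        refine Finset.sum_congr rfl fun k hk => ?_
        have := Finset.mem_range.mp hk
        rw [aux_congr r f (pad θ) n hf1 k (by omega)]
      rw [e2]
      calc _ ≤ ∑ k ∈ Finset.range (n - r + X), |dseq^[r] f k| :=
            Finset.sum_le_sum_of_subset_of_nonneg (Finset.range_mono (by omega))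
              fun _ _ _ => abs_nonneg _
        _ = _ := by
            rw [Finset.sum_range_add]
            have : ∑ k ∈ Finset.range X, |dseq^[r] f (n - r + k)| = 0 :=
              Finset.sum_eq_zero fun k _ => by rw [hf2 _ (by omega), abs_zero]
            rw [this, add_zero]
    have hpad : ∀ j, |pad θ j| ≤ t := by
      intro j
      unfold pad
      split_ifs with h
      · refine le_trans ?_ hθ1
        refine Real.abs_le_sqrt ?_
        exact Finset.single_le_sum (f := fun i => θ i ^ 2) (fun _ _ => sq_nonneg _)
          (Finset.mem_univ _)
      · simpa using ht.le
    have hc0 : ∀ i < r, |dseq^[i] f 0| ≤ 2 ^ i * t := by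
      intro i hi
      rw [aux_congr i f (pad θ) n hf1 0 (by omega)]
      exact aux_dbound t i (pad θ) hpad 0
    obtain ⟨a0, ha0, hd0⟩ := hT0cov (fun i => dseq^[i] f 0) hc0
    choose a ha hd using fun l : Fin L => hTcov l f hfW
    refine ⟨a0 + ∑ l, a l, ?_, ?_⟩
    · rw [hU, Finset.mem_image]
      exact ⟨(a0, a), Finset.mem_product.mpr ⟨ha0, Fintype.mem_piFinset.mpr ha⟩, rfl⟩
    · have hdec : θ - (a0 + ∑ l, a l) =
          ((fun j : Fin n => ∑ i ∈ Finset.range r, (((j : ℕ).choose i : ℕ) : ℝ) * dseq^[i] f 0) - a0)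
          + ∑ l : Fin L, ((fun j : Fin n =>
            auxP r f (L - 1 - l) j - auxP r f (L - 1 - l + 1) j) - a l) := by
        funext j
        have h1 : θ j = f j := by
          rw [hf1 j j.2]; simp [pad]
        have h2 : ∑ l : Fin L, (auxP r f (L - 1 - l) j - auxP r f (L - 1 - l + 1) j) =
            auxP r f 0 j - auxP r f L j := by
          rw [← Finset.sum_range (fun l => auxP r f (L - 1 - l) j - auxP r f (L - 1 - l + 1) j),
            Finset.sum_range_reflect (fun s => auxP r f s j - auxP r f (s + 1) j) L,
            Finset.sum_range_sub']
        rw [auxP_zero r hr, auxP_top r f L j (lt_of_lt_of_le j.2 hnL)] at h2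
        simp only [Pi.sub_apply, Pi.add_apply, Finset.sum_apply, Finset.sum_sub_distrib] at h2 ⊢
        rw [h1, h2]
        ring
      rw [hdec]
      refine (aux_eunorm_add _ _).trans ?_
      have h3 : eunorm (∑ l : Fin L, ((fun j : Fin n =>
            auxP r f (L - 1 - l) j - auxP r f (L - 1 - l + 1) j) - a l)) ≤ ε / 2 := by
        refine (aux_eunorm_sum _ _).trans ?_
        calc _ ≤ ∑ l : Fin L, ε / 32 * (7 / 8 : ℝ) ^ (((l : ℕ) - l0) + (l0 - (l : ℕ))) :=
              Finset.sum_le_sum fun l _ => hd l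
          _ = ε / 32 * ∑ l ∈ Finset.range L, (7 / 8 : ℝ) ^ ((l - l0) + (l0 - l)) := by
              rw [← Finset.mul_sum, Finset.sum_range]
          _ ≤ ε / 32 * (2 / (1 - 7 / 8)) := by
              have := aux_two_sided (7 / 8) (by norm_num) (by norm_num) l0 L
              gcongr
          _ = ε / 2 := by ring
      linarith
  have hle := aux_covN ε _ U hcov
  have hUcard : (U.card : ℝ) ≤ T0.card * ∏ l, ((T l).card : ℝ) := by
    have h1 : U.card ≤ (T0 ×ˢ Fintype.piFinset T).card := Finset.card_image_le
    rw [Finset.card_product, Fintype.card_piFinset] at h1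
    exact_mod_cast h1
  have hTne : ∀ l, ((T l).card : ℝ) ≠ 0 := fun l => by exact_mod_cast (hTpos l).ne'
  have hT0ne : (T0.card : ℝ) ≠ 0 := by exact_mod_cast hT0pos.ne'
  have hlogT : ∑ l : Fin L, Real.log (T l).card ≤ 8 * C1 * (2 * Y + 1) := by
    calc _ ≤ ∑ l : Fin L, C1 * 2 ^ l0 * (3 / 4 : ℝ) ^ (((l : ℕ) - l0) + (l0 - (l : ℕ))) :=
          Finset.sum_le_sum fun l _ => hTlog l
      _ = C1 * 2 ^ l0 * ∑ l ∈ Finset.range L, (3 / 4 : ℝ) ^ ((l - l0) + (l0 - l)) := by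
          rw [← Finset.mul_sum, Finset.sum_range]
      _ ≤ C1 * (2 * Y + 1) * (2 / (1 - 3 / 4)) := by
          have := aux_two_sided (3 / 4) (by norm_num) (by norm_num) l0 L
          gcongr
      _ = _ := by ring
  have hbig : Real.log (T0.card * ∏ l, ((T l).card : ℝ)) =
      Real.log T0.card + ∑ l : Fin L, Real.log (T l).card := by
    rw [Real.log_mul hT0ne (Finset.prod_ne_zero_iff.mpr fun l _ => hTne l),
      Real.log_prod (fun l _ => hTne l)]
  have hone : (1 : ℝ) ≤ T0.card * ∏ l, ((T l).card : ℝ) := by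
    have : 1 ≤ T0.card * ∏ l, (T l).card :=
      Nat.succ_le_of_lt (Nat.mul_pos hT0pos (Finset.prod_pos fun l _ => hTpos l))
    exact_mod_cast this
  have hfin : Real.log (covN ε
      {θ : Fin n → ℝ | eunorm θ ≤ t ∧ Dl1 r θ ≤ V * (n : ℝ) ^ (1 - (r : ℤ))}) ≤
      Real.log (T0.card * ∏ l, ((T l).card : ℝ)) := by
    rcases Nat.eq_zero_or_pos (covN ε
      {θ : Fin n → ℝ | eunorm θ ≤ t ∧ Dl1 r θ ≤ V * (n : ℝ) ^ (1 - (r : ℤ))}) with h | h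
    · rw [h, Nat.cast_zero, Real.log_zero]
      exact Real.log_nonneg hone
    · refine Real.log_le_log (by exact_mod_cast h) (le_trans ?_ hUcard)
      exact_mod_cast hle
  have hp : 0 ≤ r * Real.log (4 * r) * Y := by positivity
  rw [hbig] at hfin
  linarith [hfin, hlogT, hT0log, hp]
end
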